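/- Let -1 ≤ B < A ≤ 1 and f ∈ S*(A,B), and write z/f(z) = 1 + Σ_{n≥1} a_n(-1,f) zⁿ on the unit disk. Then |a_n(-1,f)| ≤ (A-B)/n for every n ≥ 1. -/

import Mathlib

open Metric Complex

/-- The class `S*(A,B)`. -/
def IsJanowskiStarlike (A B : ℝ) (f : ℂ → ℂ) : Prop :=
  AnalyticOn ℂ f (ball 0 1) ∧ f 0 = 0 ∧ deriv f 0 = 1 ∧
    ∃ ω : ℂ → ℂ, AnalyticOn ℂ ω (ball 0 1) ∧ (∀ z ∈ ball (0 : ℂ) 1, ‖ω z‖ ≤ 1) ∧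
      ∀ z ∈ ball (0 : ℂ) 1,
        z * deriv f z * (1 + (B : ℂ) * z * ω z) = f z * (1 + (A : ℂ) * z * ω z)

/-- `a` is the sequence of Taylor coefficients of the branch of `(f z / z) ^ (-lam)`
normalized to equal `1` at the origin. -/
def NegPowCoeff (lam : ℝ) (f : ℂ → ℂ) (a : ℕ → ℂ) : Prop :=
  ∃ h : ℂ → ℂ, AnalyticOn ℂ h (ball 0 1) ∧ h 0 = 0 ∧
    (∀ z ∈ ball (0 : ℂ) 1, f z = z * Complex.exp (h z)) ∧
    a 0 = 1 ∧
    ∀ z ∈ ball (0 : ℂ) 1,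
      HasSum (fun n : ℕ => a n * z ^ n) (Complex.exp (-(lam : ℂ) * h z))

lemma bessel_circle (b q : ℕ → ℂ) (n : ℕ) (hb : Summable fun k => ‖b k‖)
    (h : ∀ u : ℂ, ‖u‖ = 1 → ‖∑' k, b k * u ^ k‖ ≤ ‖∑ k ∈ Finset.range n, q k * u ^ k‖) :
    ∑ k ∈ Finset.range n, ‖b k‖ ^ 2 ≤ ∑ k ∈ Finset.range n, ‖q k‖ ^ 2 := by
  have : Fact ((0 : ℝ) < 1) := ⟨one_pos⟩
  let e : ℕ → C(AddCircle (1 : ℝ), ℂ) := fun k => fourier (k : ℤ)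
  let L := ContinuousMap.toLp (E := ℂ) 2 (@AddCircle.haarAddCircle (1 : ℝ) _) ℂ
  have hon : Orthonormal ℂ (fun k : ℕ => L (e k)) :=
    (orthonormal_fourier (T := (1 : ℝ))).comp (fun k : ℕ => (k : ℤ)) Nat.cast_injective
  have he : ∀ k x, e k x = (e 1 x) ^ k := by
    intro k x
    induction k with
    | zero => simp [e]
    | succ k ih =>
      rw [pow_succ, ← ih]
      simp only [e]
      push_cast
      rw [fourier_add]
  have hn1 : ∀ x, ‖e 1 x‖ = 1 := fun x => Circle.norm_coe _
  have hs : Summable fun k => b k • e k := by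
    refine Summable.of_norm ?_
    convert! hb using 2 with k
    rw [norm_smul, fourier_norm, mul_one]
  let F := ∑' k, b k • e k
  let Q := ∑ k ∈ Finset.range n, q k • e k
  have hF : ∀ x, F x = ∑' k, b k * (e 1 x) ^ k := by
    intro x
    have h1 := ContinuousMap.tsum_apply hs x
    rw [← h1]
    exact tsum_congr fun k => by rw [ContinuousMap.smul_apply, he k x, smul_eq_mul]
  have hQ : ∀ x, Q x = ∑ k ∈ Finset.range n, q k * (e 1 x) ^ k := by
    intro x
    simp only [Q, ContinuousMap.sum_apply]
    exact Finset.sum_congr rfl fun k _ => by rw [ContinuousMap.smul_apply, he k x, smul_eq_mul]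
  have hle : ‖L F‖ ≤ ‖L Q‖ := by
    apply MeasureTheory.Lp.norm_le_norm_of_ae_le
    filter_upwards [ContinuousMap.coeFn_toLp (p := 2) (𝕜 := ℂ) (@AddCircle.haarAddCircle (1 : ℝ) _) F,
      ContinuousMap.coeFn_toLp (p := 2) (𝕜 := ℂ) (@AddCircle.haarAddCircle (1 : ℝ) _) Q] with x h1 h2
    rw [h1, h2, hF, hQ]
    exact h _ (hn1 x)
  have hin : ∀ k, inner ℂ (L (e k)) (L F) = b k := by
    intro k
    have h1 : HasSum (fun j => inner ℂ (L (e k)) (L (b j • e j))) (inner ℂ (L (e k)) (L F)) :=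
      (hs.hasSum.mapL L).mapL (innerSL ℂ (L (e k)))
    have h2 := hasSum_single (f := fun j => inner ℂ (L (e k)) (L (b j • e j))) k (by
      intro j hj
      rw [map_smul, inner_smul_right, orthonormal_iff_ite.mp hon, if_neg (Ne.symm hj), mul_zero])
    rw [h1.unique h2, map_smul, inner_smul_right, orthonormal_iff_ite.mp hon, if_pos rfl, mul_one]
  have hB := hon.sum_inner_products_le (L F) (s := Finset.range n)
  simp only [hin] at hB
  have hQn : ‖L Q‖ ^ 2 = ∑ k ∈ Finset.range n, ‖q k‖ ^ 2 := by
    have : L Q = ∑ k ∈ Finset.range n, q k • L (e k) := by simp [Q]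
    rw [this]
    have h3 := hon.inner_sum q q (Finset.range n)
    rw [inner_self_eq_norm_sq_to_K] at h3
    have h4 : ∀ i, (starRingEnd ℂ) (q i) * q i = ((‖q i‖ ^ 2 : ℝ) : ℂ) := by
      intro i; rw [mul_comm, Complex.mul_conj, Complex.normSq_eq_norm_sq]
    simp only [h4] at h3
    rw [← Complex.ofReal_sum] at h3
    apply Complex.ofReal_injective
    rw [← h3]
    norm_num
  rw [← hQn]
  exact hB.trans (by gcongr)

lemma summable_norm_of (d : ℕ → ℂ) (F : ℂ → ℂ)
    (h : ∀ z ∈ ball (0 : ℂ) 1, z ≠ 0 → HasSum (fun n : ℕ => d n * z ^ n) (F z))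
    (z : ℂ) (hz : z ∈ ball (0 : ℂ) 1) : Summable fun n => ‖d n * z ^ n‖ := by
  by_cases h0 : z = 0
  · subst h0
    exact (summable_of_hasFiniteSupport ((Set.finite_singleton 0).subset (by
      intro n hn
      by_contra h
      exact hn (by simp [zero_pow h]))))
  · exact (h z hz h0).summable.norm

lemma fps_of (d : ℕ → ℂ) (F : ℂ → ℂ)
    (h : ∀ z ∈ ball (0 : ℂ) 1, HasSum (fun n : ℕ => d n * z ^ n) (F z)) :
    HasFPowerSeriesOnBall F (FormalMultilinearSeries.ofScalars ℂ d) 0 1 := by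
  refine ⟨?_, one_pos, ?_⟩
  · refine ENNReal.le_of_forall_nnreal_lt fun r hr => ?_
    apply FormalMultilinearSeries.le_radius_of_summable
    have hr' : r < 1 := by exact_mod_cast hr
    have := summable_norm_of d F (fun z hz _ => h z hz) (r : ℂ) (by simpa using hr')
    simpa [FormalMultilinearSeries.ofScalars_norm] using this
  · intro y hy
    have hy' : y ∈ ball (0 : ℂ) 1 := by
      rwa [← ENNReal.ofReal_one, Metric.eball_ofReal] at hy
    simpa [FormalMultilinearSeries.ofScalars_apply_eq, mul_comm] using h y hy'

lemma coeff_unique (d d' : ℕ → ℂ) (F G : ℂ → ℂ)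
    (h : ∀ z ∈ ball (0 : ℂ) 1, HasSum (fun n : ℕ => d n * z ^ n) (F z))
    (h' : ∀ z ∈ ball (0 : ℂ) 1, HasSum (fun n : ℕ => d' n * z ^ n) (G z))
    (he : ∀ z ∈ ball (0 : ℂ) 1, z ≠ 0 → F z = G z) : d = d' := by
  have h1 := (fps_of d F h).hasFPowerSeriesAt
  have h2 := (fps_of d' G h').hasFPowerSeriesAt
  have h3 : F =ᶠ[nhds 0] G := by
    rw [← ContinuousAt.eventuallyEq_nhds_iff_eventuallyEq_nhdsNE h1.continuousAt h2.continuousAt]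
    filter_upwards [mem_nhdsWithin_of_mem_nhds (ball_mem_nhds (0 : ℂ) one_pos),
      self_mem_nhdsWithin] with z hz hz0
    exact he z hz hz0
  have := h1.eq_formalMultilinearSeries_of_eventually h2 h3
  funext n
  have h4 := congrArg (fun p => p n (fun _ => 1)) this
  simpa [FormalMultilinearSeries.ofScalars_apply_eq] using h4

lemma taylor_of (F : ℂ → ℂ) (hF : DifferentiableOn ℂ F (ball 0 1)) (z : ℂ)
    (hz : z ∈ ball (0 : ℂ) 1) :
    HasSum (fun n : ℕ => (iteratedDeriv n F 0 / n.factorial) * z ^ n) (F z) := by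
  convert! Complex.hasSum_taylorSeries_on_ball hF hz using 2 with n
  simp only [sub_zero, smul_eq_mul]; ring

lemma deriv_series (d : ℕ → ℂ) (F : ℂ → ℂ)
    (h : ∀ z ∈ ball (0 : ℂ) 1, HasSum (fun n : ℕ => d n * z ^ n) (F z)) :
    DifferentiableOn ℂ F (ball 0 1) ∧
    ∀ z ∈ ball (0 : ℂ) 1, HasSum (fun n : ℕ => ((n + 1 : ℕ) : ℂ) * d (n + 1) * z ^ n) (deriv F z) := by
  have hF : DifferentiableOn ℂ F (ball 0 1) := by
    have := (fps_of d F h).differentiableOn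
    rwa [← ENNReal.ofReal_one, Metric.eball_ofReal] at this
  refine ⟨hF, fun z hz => ?_⟩
  have hd := coeff_unique d _ F F h (fun z hz => taylor_of F hF z hz) (fun _ _ _ => rfl)
  convert! taylor_of (deriv F) (hF.deriv isOpen_ball) z hz using 3 with n
  rw [hd, ← iteratedDeriv_succ']
  simp only [Nat.factorial_succ]
  have := Nat.factorial_ne_zero n
  push_cast
  field_simp

/-- Contraction property of multiplication by a Schur function, on coefficients. -/
lemma clunie (ω P Q : ℂ → ℂ) (p q : ℕ → ℂ) (hω : DifferentiableOn ℂ ω (ball 0 1))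
    (hω1 : ∀ z ∈ ball (0 : ℂ) 1, ‖ω z‖ ≤ 1)
    (hp : ∀ z ∈ ball (0 : ℂ) 1, HasSum (fun n : ℕ => p n * z ^ n) (P z))
    (hq : ∀ z ∈ ball (0 : ℂ) 1, HasSum (fun n : ℕ => q n * z ^ n) (Q z))
    (he : ∀ z ∈ ball (0 : ℂ) 1, z ≠ 0 → P z = ω z * Q z) (n : ℕ) :
    ∑ k ∈ Finset.range n, ‖p k‖ ^ 2 ≤ ∑ k ∈ Finset.range n, ‖q k‖ ^ 2 := by
  obtain ⟨c, hc⟩ : ∃ c : ℕ → ℂ, ∀ z ∈ ball (0 : ℂ) 1, HasSum (fun n : ℕ => c n * z ^ n) (ω z) :=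
    ⟨_, taylor_of ω hω⟩
  have prod : ∀ (s : ℕ → ℂ) (S : ℂ → ℂ),
      (∀ z ∈ ball (0 : ℂ) 1, HasSum (fun n : ℕ => s n * z ^ n) (S z)) →
      ∀ z ∈ ball (0 : ℂ) 1, HasSum (fun n : ℕ =>
        (∑ kl ∈ Finset.HasAntidiagonal.antidiagonal n, c kl.1 * s kl.2) * z ^ n) (ω z * S z) := by
    intro s S hs z hz
    have h1 := summable_norm_of c ω (fun z hz _ => hc z hz) z hz
    have h2 := summable_norm_of s S (fun z hz _ => hs z hz) z hz
    have h3 := tsum_mul_tsum_eq_tsum_sum_antidiagonal_of_summable_norm h1 h2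
    have h4 := (summable_norm_sum_mul_antidiagonal_of_summable_norm h1 h2).of_norm.hasSum
    rw [← h3, (hc z hz).tsum_eq, (hs z hz).tsum_eq] at h4
    convert! h4 using 2 with m
    rw [Finset.sum_mul]
    refine Finset.sum_congr rfl fun kl hkl => ?_
    rw [← Finset.HasAntidiagonal.mem_antidiagonal.mp hkl, pow_add]; ring
  have hpc := coeff_unique p _ P _ hp (prod q Q hq) he
  let t : ℕ → ℂ := fun k => if k < n then q k else 0
  let T : ℂ → ℂ := fun z => ∑ k ∈ Finset.range n, q k * z ^ k
  have ht : ∀ z ∈ ball (0 : ℂ) 1, HasSum (fun n : ℕ => t n * z ^ n) (T z) := by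
    intro z _
    have : T z = ∑ k ∈ Finset.range n, t k * z ^ k :=
      Finset.sum_congr rfl fun k hk => by simp [t, Finset.mem_range.mp hk]
    rw [this]
    apply hasSum_sum_of_ne_finset_zero
    intro k hk
    simp [t, Finset.mem_range] at hk ⊢
    intro h; omega
  have hb := prod t T ht
  set b : ℕ → ℂ := fun n => ∑ kl ∈ Finset.HasAntidiagonal.antidiagonal n, c kl.1 * t kl.2 with hbdef
  have hpb : ∀ k < n, p k = b k := by
    intro k hk
    rw [hpc]
    refine Finset.sum_congr rfl fun kl hkl => ?_
    have := Finset.HasAntidiagonal.mem_antidiagonal.mp hkl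
    simp only [t]
    rw [if_pos (by omega)]
  have key : ∀ r : ℝ, 0 < r → r < 1 →
      ∑ k ∈ Finset.range n, ‖p k * r ^ k‖ ^ 2 ≤ ∑ k ∈ Finset.range n, ‖q k * r ^ k‖ ^ 2 := by
    intro r hr0 hr1
    have hmem : ∀ u : ℂ, ‖u‖ = 1 → (r * u : ℂ) ∈ ball (0 : ℂ) 1 := by
      intro u hu
      simp [hu, abs_of_pos hr0, hr1]
    have := bessel_circle (fun k => b k * r ^ k) (fun k => q k * r ^ k) n
      (summable_norm_of b _ (fun z hz _ => hb z hz) r (by simpa using hmem 1 (by simp))) (by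
        intro u hu
        have h1 := (hb _ (hmem u hu)).tsum_eq
        simp only [mul_pow, ← mul_assoc] at h1
        rw [h1]
        have h2 : T (r * u) = ∑ k ∈ Finset.range n, q k * r ^ k * u ^ k := by
          simp only [T, mul_pow, mul_assoc]
        rw [← h2, norm_mul]
        exact mul_le_of_le_one_left (norm_nonneg _) (hω1 _ (hmem u hu)))
    refine le_trans (le_of_eq (Finset.sum_congr rfl fun k hk => ?_)) this
    rw [hpb k (Finset.mem_range.mp hk)]
  have lim : ∀ s : ℕ → ℂ, Filter.Tendsto (fun r : ℝ => ∑ k ∈ Finset.range n, ‖s k * r ^ k‖ ^ 2)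
      (nhdsWithin 1 (Set.Iio 1)) (nhds (∑ k ∈ Finset.range n, ‖s k‖ ^ 2)) := by
    intro s
    have : Continuous (fun r : ℝ => ∑ k ∈ Finset.range n, ‖s k * (r : ℂ) ^ k‖ ^ 2) := by fun_prop
    have h2 := (this.tendsto 1).mono_left (nhdsWithin_le_nhds (s := Set.Iio 1))
    simpa using h2
  refine le_of_tendsto_of_tendsto (lim p) (lim q) ?_
  filter_upwards [Ioo_mem_nhdsLT (zero_lt_one' ℝ)] with r hr
  exact key r hr.1 hr.2

theorem inverse_power_coeff_bound (A B : ℝ) (hB : -1 ≤ B) (hBA : B < A) (hA : A ≤ 1)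
    (f : ℂ → ℂ) (hf : IsJanowskiStarlike A B f)
    (a : ℕ → ℂ) (ha0 : a 0 = 1)
    (ha : ∀ z ∈ ball (0 : ℂ) 1, z ≠ 0 → HasSum (fun n : ℕ => a n * z ^ n) (z / f z))
    (n : ℕ) (hn : 1 ≤ n) :
    ‖a n‖ ≤ (A - B) / n := by
  obtain ⟨hfa, hf0, hf1, ω, hωa, hω1, hfe⟩ := hf
  have hfd : DifferentiableOn ℂ f (ball 0 1) := hfa.differentiableOn
  have hωd : DifferentiableOn ℂ ω (ball 0 1) := hωa.differentiableOn
  let g : ℂ → ℂ := fun z => ∑' n, a n * z ^ n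
  have hg : ∀ z ∈ ball (0 : ℂ) 1, HasSum (fun n : ℕ => a n * z ^ n) (g z) := fun z hz =>
    (summable_norm_of a _ ha z hz).of_norm.hasSum
  obtain ⟨hgd, hg'⟩ := deriv_series a g hg
  have hgz : ∀ z ∈ ball (0 : ℂ) 1, z ≠ 0 → g z = z / f z := fun z hz h0 => (ha z hz h0).tsum_eq
  have hb0 : (0 : ℂ) ∈ ball (0 : ℂ) 1 := by simp
  -- `g f = z` on the disk
  have hfne : ∀ᶠ z in nhdsWithin (0 : ℂ) {0}ᶜ, f z ≠ 0 := by
    have : HasDerivAt f 1 0 := by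
      rw [← hf1]
      exact (hfd.differentiableAt (isOpen_ball.mem_nhds hb0)).hasDerivAt
    exact this.eventually_ne one_ne_zero
  have hgf : Set.EqOn (fun z => g z * f z) (fun z => z) (ball 0 1) := by
    apply AnalyticOnNhd.eqOn_of_preconnected_of_frequently_eq
      ((hgd.mul hfd).analyticOnNhd isOpen_ball) (analyticOnNhd_id)
      (convex_ball (0 : ℂ) 1).isPreconnected hb0
    apply Filter.Eventually.frequently
    filter_upwards [hfne, mem_nhdsWithin_of_mem_nhds (ball_mem_nhds (0 : ℂ) one_pos),
      self_mem_nhdsWithin] with z h1 h2 h3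
    simp only [Pi.mul_apply]
    rw [hgz z h2 h3]
    exact div_mul_cancel₀ _ h1
  have hode : ∀ z ∈ ball (0 : ℂ) 1, z ≠ 0 →
      deriv g z = ω z * (-(((A : ℂ) - B) * g z + B * (z * deriv g z))) := by
    intro z hz h0
    have h1 : deriv g z * f z + g z * deriv f z = 1 := by
      have h2 := ((hgd.differentiableAt (isOpen_ball.mem_nhds hz)).hasDerivAt).mul
        ((hfd.differentiableAt (isOpen_ball.mem_nhds hz)).hasDerivAt)
      have h3 : HasDerivAt (fun z => g z * f z) 1 z :=
        (hasDerivAt_id z).congr_of_eventuallyEq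
          (Filter.eventuallyEq_of_mem (isOpen_ball.mem_nhds hz) hgf)
      exact h2.unique h3
    have h4 : g z * f z = z := hgf hz
    have h5 := hfe z hz
    have h6 : z ^ 2 * (deriv g z - ω z * (-(((A : ℂ) - B) * g z + B * (z * deriv g z)))) = 0 := by
      linear_combination (g z * z * (1 + B * z * ω z)) * h1 - g z ^ 2 * h5
        + (-g z * (1 + A * z * ω z) - z * deriv g z * (1 + B * z * ω z)) * h4
    have h7 := (mul_eq_zero.mp h6).resolve_left (pow_ne_zero 2 h0)
    exact sub_eq_zero.mp h7
  have hzg' : ∀ z ∈ ball (0 : ℂ) 1, HasSum (fun k : ℕ => (k : ℂ) * a k * z ^ k) (z * deriv g z) := by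
    intro z hz
    rw [← hasSum_nat_add_iff' 1]
    simp only [Finset.sum_range_one, Nat.cast_zero, zero_mul, sub_zero]
    convert! (hg' z hz).mul_left z using 2 with k
    rw [pow_succ]; ring
  have hq : ∀ z ∈ ball (0 : ℂ) 1, HasSum (fun k : ℕ => (-(((A : ℂ) - B) + B * k) * a k) * z ^ k)
      (-(((A : ℂ) - B) * g z + B * (z * deriv g z))) := by
    intro z hz
    convert! (((hg z hz).mul_left ((A : ℂ) - B)).add ((hzg' z hz).mul_left (B : ℂ))).neg using 2 with k
    ring
  obtain ⟨m, rfl⟩ : ∃ m, n = m + 1 := ⟨n - 1, by omega⟩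
  have hC := clunie ω _ _ _ _ hωd hω1 hg' hq hode (m + 1)
  rw [Finset.sum_range_succ, Finset.sum_range_succ' (fun k => ‖-((A : ℂ) - B + B * k) * a k‖ ^ 2)] at hC
  have hterm : ∑ k ∈ Finset.range m, ‖-((A : ℂ) - B + B * ((k + 1 : ℕ) : ℂ)) * a (k + 1)‖ ^ 2 ≤
      ∑ k ∈ Finset.range m, ‖((k + 1 : ℕ) : ℂ) * a (k + 1)‖ ^ 2 := by
    refine Finset.sum_le_sum fun k _ => ?_
    have hk : (0 : ℝ) ≤ k := k.cast_nonneg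
    have h1 : ‖-((A : ℂ) - B + B * ((k + 1 : ℕ) : ℂ))‖ ≤ ‖((k + 1 : ℕ) : ℂ)‖ := by
      have : (A : ℂ) - B + B * ((k + 1 : ℕ) : ℂ) = ((A + B * k : ℝ) : ℂ) := by push_cast; ring
      rw [norm_neg, this, Complex.norm_real, Complex.norm_natCast, Real.norm_eq_abs, abs_le]
      push_cast
      constructor <;> nlinarith
    rw [norm_mul, norm_mul]
    gcongr
  have h0 : ‖-((A : ℂ) - B + B * ((0 : ℕ) : ℂ)) * a 0‖ = A - B := by
    have : -((A : ℂ) - B + B * ((0 : ℕ) : ℂ)) * a 0 = ((-(A - B) : ℝ) : ℂ) := by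
      rw [ha0]; push_cast; ring
    rw [this, Complex.norm_real, norm_neg, Real.norm_eq_abs, abs_of_pos (by linarith)]
  rw [h0] at hC
  have h2 : ‖((m + 1 : ℕ) : ℂ) * a (m + 1)‖ ^ 2 ≤ (A - B) ^ 2 := by linarith
  have h3 := abs_le_of_sq_le_sq h2 (by linarith)
  rw [abs_of_nonneg (norm_nonneg _), norm_mul, Complex.norm_natCast] at h3
  rw [le_div_iff₀ (by positivity)]
  linarith
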